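/- arXiv:2002.05586 — 2 statements merged into one kernel-verified Lean document; each statement's English description precedes it below -/
import Mathlib

section
/- Let g be a finite-dimensional complex semisimple Lie algebra, α ∈ Δ₊ a positive root, and let M be a U(g)-module that is free as a module over the unital subalgebra ℂ[f_α] of U(g) generated by f_α. Then the annihilator of T_α(M) in U(g) equals the annihilator of M in U(g): {a ∈ U(g) : a·w = 0 for all w ∈ T_α(M)} = {a ∈ U(g) : a·v = 0 for all v ∈ M}. -/
open LieAlgebra

/-- `ι : M →ₗ[A] M'` realizes `M'` as the Ore localization `M_{(f)}` of the left `A`-module `M`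
at the powers of `f`: the action of `f` on `M'` is bijective, every element of `M'` has the form
`f^{-n} • (ι v)`, and the kernel of the canonical map `ι` is the `f`-power torsion of `M`. -/
structure IsOreLocalizationAtPowers {A : Type*} [Ring A] (f : A)
    {M M' : Type*} [AddCommGroup M] [Module A M] [AddCommGroup M'] [Module A M']
    (ι : M →ₗ[A] M') : Prop where
  smul_bijective : Function.Bijective fun w : M' => f • w
  exists_pow_smul_mem : ∀ w : M', ∃ (n : ℕ) (v : M), f ^ n • w = ι v
  ker_eq_torsion : ∀ v : M, ι v = 0 → ∃ n : ℕ, f ^ n • v = 0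


section TwistAux

/-- `LNil f a`: some iterate of `ad f` kills `a`. -/
inductive LNil {A : Type*} [Ring A] (f : A) : ℕ → A → Prop
  | zero : LNil f 0 0
  | step (n : ℕ) (a : A) : LNil f n (f * a - a * f) → LNil f (n + 1) a

variable {A : Type*} [Ring A] {f : A}

theorem lnil_zero_iff {a : A} : LNil f 0 a ↔ a = 0 := by
  constructor
  · intro h
    cases h
    rfl
  · rintro rfl
    exact LNil.zero

theorem lnil_succ_iff {n : ℕ} {a : A} : LNil f (n + 1) a ↔ LNil f n (f * a - a * f) := by
  constructor
  · intro h
    cases h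
    assumption
  · exact LNil.step n a

theorem lnil_zero (n : ℕ) : LNil f n (0 : A) := by
  induction n with
  | zero => exact LNil.zero
  | succ n ih => exact lnil_succ_iff.2 (by simpa using ih)

theorem lnil_mono_succ {n : ℕ} : ∀ {a : A}, LNil f n a → LNil f (n + 1) a := by
  induction n with
  | zero =>
    intro a h
    rw [lnil_zero_iff] at h
    subst h
    exact lnil_zero _
  | succ n ih =>
    intro a h
    exact lnil_succ_iff.2 (ih (lnil_succ_iff.1 h))

theorem lnil_mono {n m : ℕ} (h : n ≤ m) {a : A} (ha : LNil f n a) : LNil f m a := by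
  induction h with
  | refl => exact ha
  | step _ ih => exact lnil_mono_succ ih

theorem lnil_add {n : ℕ} : ∀ {a b : A}, LNil f n a → LNil f n b → LNil f n (a + b) := by
  induction n with
  | zero =>
    intro a b ha hb
    rw [lnil_zero_iff] at *
    simp [ha, hb]
  | succ n ih =>
    intro a b ha hb
    rw [lnil_succ_iff] at *
    have := ih ha hb
    convert this using 1
    noncomm_ring

theorem lnil_mul (s : ℕ) : ∀ {n m : ℕ} {a b : A}, n + m ≤ s → LNil f n a → LNil f m b →
    LNil f s (a * b) := by
  induction s with
  | zero =>
    intro n m a b h ha hb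
    obtain rfl : n = 0 := by omega
    rw [lnil_zero_iff] at *
    simp [ha]
  | succ s ih =>
    intro n m a b h ha hb
    rcases n with _ | n
    · rw [lnil_zero_iff] at ha
      subst ha
      simpa using lnil_zero (f := f) (s + 1)
    rcases m with _ | m
    · rw [lnil_zero_iff] at hb
      subst hb
      simpa using lnil_zero (f := f) (s + 1)
    have h1 := ih (n := n) (m := m + 1) (by omega) (lnil_succ_iff.1 ha) hb
    have h2 := ih (n := n + 1) (m := m) (by omega) ha (lnil_succ_iff.1 hb)
    rw [lnil_succ_iff]
    have := lnil_add h1 h2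
    convert this using 1
    noncomm_ring

variable {M M' : Type*} [AddCommGroup M] [Module A M] [AddCommGroup M'] [Module A M']

theorem ann_loc {ι : M →ₗ[A] M'} (hloc : IsOreLocalizationAtPowers f ι) (N : ℕ) :
    ∀ (a : A), LNil f N a → (∀ v : M, a • v = 0) → ∀ w : M', a • w = 0 := by
  induction N with
  | zero =>
    intro a ha _ w
    rw [lnil_zero_iff] at ha
    simp [ha]
  | succ N ihN =>
    intro a ha hav
    have hc : ∀ w : M', (f * a - a * f) • w = 0 :=
      ihN _ (lnil_succ_iff.1 ha) (fun v => by simp [sub_smul, mul_smul, hav])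
    have key : ∀ (n : ℕ) (w : M') (v : M), f ^ n • w = ι v → a • w = 0 := by
      intro n
      induction n with
      | zero =>
        intro w v h
        simp only [pow_zero, one_smul] at h
        rw [h, ← map_smul, hav, map_zero]
      | succ n ih =>
        intro w v h
        have h1 : a • f • w = 0 := ih (f • w) v (by rw [← h, pow_succ, mul_smul])
        have h2 := hc w
        rw [sub_smul, mul_smul, mul_smul, h1, sub_zero] at h2
        apply hloc.smul_bijective.1
        simpa using h2
    intro w
    obtain ⟨n, v, h⟩ := hloc.exists_pow_smul_mem w
    exact key n w v h

theorem div_loc {ι : M →ₗ[A] M'} (hloc : IsOreLocalizationAtPowers f ι) (N : ℕ) :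
    ∀ (a : A), LNil f N a → (∀ w : M', ∃ v, ι v = a • w) →
      ∀ (n : ℕ) (w : M'), ∃ v : M, a • w = ι (f ^ n • v) := by
  induction N with
  | zero =>
    intro a ha _ n w
    rw [lnil_zero_iff] at ha
    exact ⟨0, by simp [ha]⟩
  | succ N ihN =>
    intro a ha hav
    have hc := ihN _ (lnil_succ_iff.1 ha) (fun w => by
      obtain ⟨v, hv⟩ := hav w
      obtain ⟨u, hu⟩ := hav (f • w)
      exact ⟨f • v - u, by simp [sub_smul, mul_smul, hv, hu]⟩)
    intro n
    induction n with
    | zero =>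
      intro w
      obtain ⟨v, hv⟩ := hav w
      exact ⟨v, by simp [hv]⟩
    | succ n ih =>
      intro w
      obtain ⟨w, rfl⟩ := hloc.smul_bijective.2 w
      obtain ⟨v, hv⟩ := ih w
      obtain ⟨u, hu⟩ := hc (n + 1) w
      refine ⟨v - u, ?_⟩
      rw [smul_sub, map_sub, ← hu, pow_succ', mul_smul, map_smul, ← hv, sub_smul, mul_smul,
        mul_smul]
      simp

/-- The general statement. -/
theorem ann_general {ι : M →ₗ[A] M'} (hloc : IsOreLocalizationAtPowers f ι)
    (hnil : ∀ a : A, ∃ N, LNil f N a)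
    (hinj : ∀ v : M, f • v = 0 → v = 0)
    (hsep : ∀ v : M, (∀ n : ℕ, ∃ u : M, v = f ^ n • u) → v = 0) :
    {a : A | ∀ w : M' ⧸ LinearMap.range ι, a • w = 0} = {a : A | ∀ v : M, a • v = 0} := by
  have hι : Function.Injective ι := by
    rw [injective_iff_map_eq_zero]
    intro v hv
    obtain ⟨n, hn⟩ := hloc.ker_eq_torsion v hv
    induction n with
    | zero => simpa using hn
    | succ n ih =>
      apply ih
      apply hinj
      rw [← mul_smul, ← pow_succ', hn]
  ext a
  obtain ⟨N, hN⟩ := hnil a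
  simp only [Set.mem_setOf_eq]
  constructor
  · intro h v
    have h' : ∀ w : M', ∃ v, ι v = a • w := by
      intro w
      have := h (Submodule.Quotient.mk w)
      rw [← Submodule.Quotient.mk_smul, Submodule.Quotient.mk_eq_zero] at this
      exact this
    apply hsep
    intro n
    obtain ⟨u, hu⟩ := div_loc hloc N a hN h' n (ι v)
    exact ⟨u, hι (by rw [map_smul, hu])⟩
  · intro h w
    obtain ⟨w, rfl⟩ := Submodule.Quotient.mk_surjective _ w
    rw [← Submodule.Quotient.mk_smul, ann_loc hloc N a hN h w, Submodule.Quotient.mk_zero]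

end TwistAux

section FreeAux

open Polynomial in
theorem free_facts {A : Type*} [Ring A] [Algebra ℂ A] (f : A)
    (htr : ∀ p : ℂ[X], aeval f p = 0 → p = 0)
    {M : Type*} [AddCommGroup M] [Module A M]
    [Module.Free (Algebra.adjoin ℂ ({f} : Set A)) M] :
    (∀ v : M, f • v = 0 → v = 0) ∧
      (∀ v : M, (∀ n : ℕ, ∃ u : M, v = f ^ n • u) → v = 0) := by
  let F : Algebra.adjoin ℂ ({f} : Set A) := ⟨f, Algebra.self_mem_adjoin_singleton ℂ f⟩
  have hsurj : ∀ r : Algebra.adjoin ℂ ({f} : Set A), ∃ p : ℂ[X], aeval F p = r := by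
    rintro ⟨r, hr⟩
    rw [Algebra.adjoin_singleton_eq_range_aeval] at hr
    obtain ⟨p, hp⟩ := hr
    refine ⟨p, Subtype.ext ?_⟩
    rw [← Subalgebra.coe_val, ← Polynomial.aeval_algHom_apply]
    exact hp
  have hinj : ∀ p : ℂ[X], aeval F p = 0 → p = 0 := by
    intro p hp
    apply htr
    have := congrArg (Subalgebra.val _) hp
    rw [← Polynomial.aeval_algHom_apply, map_zero] at this
    exact this
  have hFs : ∀ (n : ℕ) (v : M), f ^ n • v = F ^ n • v := fun n v => rfl
  let b := Module.Free.chooseBasis (Algebra.adjoin ℂ ({f} : Set A)) M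
  constructor
  · intro v hv
    have hv' : F • v = 0 := hv
    apply b.ext_elem
    intro i
    have h1 := congrArg (fun w => b.repr w i) hv'
    simp only [map_smul, Finsupp.smul_apply, smul_eq_mul, map_zero, Finsupp.zero_apply] at h1 ⊢
    obtain ⟨p, hp⟩ := hsurj (b.repr v i)
    rw [← hp] at h1 ⊢
    have h2 : aeval F (X * p) = 0 := by simpa using h1
    have h3 := hinj _ h2
    have h4 : p = 0 := by simpa using h3
    simp [h4]
  · intro v hv
    apply b.ext_elem
    intro i
    obtain ⟨p, hp⟩ := hsurj (b.repr v i)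
    have hdvd : ∀ n : ℕ, X ^ n ∣ p := by
      intro n
      obtain ⟨u, hu⟩ := hv n
      rw [hFs] at hu
      obtain ⟨q, hq⟩ := hsurj (b.repr u i)
      refine ⟨q, ?_⟩
      rw [← sub_eq_zero]
      apply hinj
      simp only [map_sub, map_mul, map_pow, aeval_X, hp, hq]
      rw [hu]
      simp
    have hp0 : p = 0 := by
      by_contra h
      have h1 := Polynomial.natDegree_le_of_dvd (hdvd (p.natDegree + 1)) h
      simp at h1
    rw [← hp, hp0]
    simp

end FreeAux

section UEAAux

attribute [local instance] LieRing.ofAssociativeRing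


open UniversalEnvelopingAlgebra

variable {L : Type*} [LieRing L] [LieAlgebra ℂ L]

theorem uea_mem (S : Subalgebra ℂ (UniversalEnvelopingAlgebra ℂ L))
    (hS : ∀ x : L, UniversalEnvelopingAlgebra.ι ℂ x ∈ S)
    (a : UniversalEnvelopingAlgebra ℂ L) : a ∈ S := by
  let g : L →ₗ⁅ℂ⁆ S :=
    { toFun := fun x => ⟨UniversalEnvelopingAlgebra.ι ℂ x, hS x⟩
      map_add' := fun x y => Subtype.ext (map_add _ x y)
      map_smul' := fun c x => Subtype.ext (map_smul _ c x)
      map_lie' := fun {x y} => Subtype.ext (by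
        rw [LieRing.of_associative_ring_bracket]
        simp only [LieHom.map_lie, LieRing.of_associative_ring_bracket]
        rfl) }
  have h : S.val.comp (lift ℂ g) = AlgHom.id ℂ _ := by
    apply hom_ext
    ext x
    change ((lift ℂ g (UniversalEnvelopingAlgebra.ι ℂ x) : S) : UniversalEnvelopingAlgebra ℂ L) = _
    rw [lift_ι_apply]
    rfl
  have h2 := congrArg (fun k => k a) h
  simp only [AlgHom.comp_apply, AlgHom.id_apply] at h2
  rw [← h2]
  exact (lift ℂ g a).2

theorem uea_lnil (y : L) (hy : IsNilpotent (LieAlgebra.ad ℂ L y))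
    (a : UniversalEnvelopingAlgebra ℂ L) :
    ∃ N, LNil (UniversalEnvelopingAlgebra.ι ℂ y : UniversalEnvelopingAlgebra ℂ L) N a := by
  let S : Subalgebra ℂ (UniversalEnvelopingAlgebra ℂ L) :=
    { carrier := {a | ∃ N, LNil (UniversalEnvelopingAlgebra.ι ℂ y) N a}
      mul_mem' := by
        rintro a b ⟨n, hn⟩ ⟨m, hm⟩
        exact ⟨n + m, lnil_mul _ le_rfl hn hm⟩
      add_mem' := by
        rintro a b ⟨n, hn⟩ ⟨m, hm⟩
        exact ⟨n + m, lnil_add (lnil_mono (by omega) hn) (lnil_mono (by omega) hm)⟩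
      algebraMap_mem' := by
        intro r
        refine ⟨1, ?_⟩
        rw [lnil_succ_iff, lnil_zero_iff, sub_eq_zero]
        exact (Algebra.commutes r _).symm }
  refine uea_mem S ?_ a
  intro x
  obtain ⟨n, hn⟩ := hy
  have key : ∀ (n : ℕ) (x : L), ((LieAlgebra.ad ℂ L y) ^ n) x = 0 →
      LNil (UniversalEnvelopingAlgebra.ι ℂ y : UniversalEnvelopingAlgebra ℂ L) n
        (UniversalEnvelopingAlgebra.ι ℂ x) := by
    intro n
    induction n with
    | zero =>
      intro x hx
      have hx' : x = 0 := by simpa using hx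
      rw [hx', map_zero]
      exact lnil_zero _
    | succ n ih =>
      intro x hx
      rw [lnil_succ_iff, ← LieRing.of_associative_ring_bracket, ← LieHom.map_lie]
      apply ih
      rw [pow_succ] at hx
      simpa using hx
  exact ⟨n, key n x (by simp [hn])⟩

/-- linear forms in the polynomial ring on a basis of `L` -/
noncomputable def linForm {σ : Type*} (b : Module.Basis σ ℂ L) : L →ₗ[ℂ] MvPolynomial σ ℂ :=
  b.constr ℂ (fun i => MvPolynomial.X i)

theorem linForm_inj {σ : Type*} (b : Module.Basis σ ℂ L) (x : L) (h : linForm b x = 0) :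
    x = 0 := by
  have h1 := MvPolynomial.linearIndependent_X (σ := σ) ℂ
  rw [linForm, Module.Basis.constr_apply] at h
  have h2 := linearIndependent_iff.1 h1 (b.repr x) h
  simpa using h2

/-- the adjoint action extended to derivations -/
noncomputable def adDer {σ : Type*} (b : Module.Basis σ ℂ L) (x : L) :
    Derivation ℂ (MvPolynomial σ ℂ) (MvPolynomial σ ℂ) :=
  MvPolynomial.mkDerivation ℂ (fun i => linForm b ⁅x, b i⁆)

theorem adDer_linForm {σ : Type*} (b : Module.Basis σ ℂ L) (x y : L) :
    adDer b x (linForm b y) = linForm b ⁅x, y⁆ := by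
  have h : (adDer b x).toLinearMap ∘ₗ linForm b = linForm b ∘ₗ (LieAlgebra.ad ℂ L x) := by
    apply b.ext
    intro i
    simp only [LinearMap.comp_apply, LieAlgebra.ad_apply]
    conv_lhs => rw [linForm, Module.Basis.constr_basis]
    exact MvPolynomial.mkDerivation_X _ _ _
  exact LinearMap.congr_fun h y

theorem linForm_basis {σ : Type*} (b : Module.Basis σ ℂ L) (i : σ) :
    linForm b (b i) = MvPolynomial.X i := by
  rw [linForm, Module.Basis.constr_basis]

/-- the representation of `L` on polynomials -/
noncomputable def adRep {σ : Type*} (b : Module.Basis σ ℂ L) :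
    L →ₗ⁅ℂ⁆ Module.End ℂ (MvPolynomial σ ℂ) where
  toFun x := (adDer b x).toLinearMap
  map_add' x y := by
    have : adDer b (x + y) = adDer b x + adDer b y := by
      apply MvPolynomial.derivation_ext
      intro i
      simp only [Derivation.add_apply, ← linForm_basis b, adDer_linForm, add_lie, map_add]
    rw [this]
    rfl
  map_smul' c x := by
    have : adDer b (c • x) = c • adDer b x := by
      apply MvPolynomial.derivation_ext
      intro i
      simp only [Derivation.smul_apply, ← linForm_basis b, adDer_linForm, smul_lie, map_smul]
    rw [this]
    rfl
  map_lie' {x y} := by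
    have : adDer b ⁅x, y⁆ = ⁅adDer b x, adDer b y⁆ := by
      apply MvPolynomial.derivation_ext
      intro i
      simp only [Derivation.commutator_apply, ← linForm_basis b, adDer_linForm, lie_lie, map_sub]
    rw [this]
    rfl

theorem der_pow {B : Type*} [CommRing B] [Algebra ℂ B] (D : Derivation ℂ B B) (u c : B)
    (hu : D u = c) (hc : D c = 0) (k : ℕ) :
    ((D.toLinearMap : Module.End ℂ B) ^ k) (u ^ k) = (k.factorial : B) * c ^ k := by
  have hmul : ∀ (k : ℕ) (z g : B), D z = 0 → ((D.toLinearMap : Module.End ℂ B) ^ k) (z * g) =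
      z * ((D.toLinearMap : Module.End ℂ B) ^ k) g := by
    intro k z g hz
    induction k with
    | zero => simp
    | succ k ih =>
      rw [pow_succ', Module.End.mul_apply, Module.End.mul_apply, ih]
      change D _ = z * D _
      rw [D.leibniz, hz]
      simp
  induction k with
  | zero => simp
  | succ k ih =>
    rw [pow_succ, Module.End.mul_apply]
    have h1 : (D.toLinearMap : Module.End ℂ B) (u ^ (k + 1)) = (((k + 1 : ℕ) : B) * c) * u ^ k := by
      change D _ = _
      rw [D.leibniz_pow, hu]
      simp only [Nat.add_sub_cancel, smul_eq_mul, nsmul_eq_mul]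
      ring
    rw [h1, hmul _ _ _ (by rw [D.leibniz, hc]; simp), ih, Nat.factorial_succ]
    push_cast
    ring

open Polynomial in
theorem uea_transcendental (h y : L) (hy0 : y ≠ 0) (hhy : ⁅y, h⁆ = (2 : ℂ) • y)
    (p : ℂ[X])
    (hp : aeval (UniversalEnvelopingAlgebra.ι ℂ y : UniversalEnvelopingAlgebra ℂ L) p = 0) :
    p = 0 := by
  let b := Module.Basis.ofVectorSpace ℂ L
  let D := adDer b y
  let E : Module.End ℂ (MvPolynomial _ ℂ) := D.toLinearMap
  have hE : aeval E p = 0 := by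
    have h1 := congrArg (lift ℂ (adRep b)) hp
    rw [← Polynomial.aeval_algHom_apply, map_zero, lift_ι_apply] at h1
    exact h1
  have hu : D (linForm b h) = linForm b ((2 : ℂ) • y) := by
    rw [← hhy]
    exact adDer_linForm b y h
  have hc : D (linForm b ((2 : ℂ) • y)) = 0 := by
    have := adDer_linForm b y ((2 : ℂ) • y)
    rw [lie_smul, lie_self, smul_zero, map_zero] at this
    exact this
  have hc0 : linForm b ((2 : ℂ) • y) ≠ 0 := by
    intro h0
    have := linForm_inj b _ h0
    simp [hy0] at this
  have hpow := der_pow D _ _ hu hc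
  have hDc : ∀ k m : ℕ, k < m → (E ^ m) (linForm b h ^ k) = 0 := by
    intro k m hkm
    obtain ⟨j, rfl⟩ := Nat.exists_eq_add_of_lt hkm
    have : k + j + 1 = j + 1 + k := by ring
    rw [this, pow_add, Module.End.mul_apply, hpow, pow_succ, Module.End.mul_apply]
    have h0 : E ((k.factorial : MvPolynomial _ ℂ) * linForm b ((2 : ℂ) • y) ^ k) = 0 := by
      change D _ = 0
      rw [D.leibniz, D.leibniz_pow, hc]
      simp
    rw [h0, map_zero]
  by_contra hp0
  have hk : p.coeff p.natTrailingDegree ≠ 0 := by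
    simpa [Polynomial.trailingCoeff] using (Polynomial.trailingCoeff_nonzero_iff_nonzero.2 hp0)
  generalize hkk : p.natTrailingDegree = k at hk
  have h1 := LinearMap.congr_fun hE (linForm b h ^ k)
  rw [Polynomial.aeval_eq_sum_range, LinearMap.sum_apply, Finset.sum_eq_single k] at h1
  · rw [LinearMap.smul_apply, hpow, LinearMap.zero_apply] at h1
    rw [smul_eq_zero] at h1
    rcases h1 with h1 | h1
    · exact hk h1
    · rcases mul_eq_zero.1 h1 with h2 | h2
      · exact Nat.factorial_ne_zero k (by exact_mod_cast h2)
      · exact hc0 (by by_contra hne; exact pow_ne_zero k hne h2)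
  · intro m _ hm
    rw [LinearMap.smul_apply]
    rcases lt_or_gt_of_ne hm with h2 | h2
    · rw [Polynomial.coeff_eq_zero_of_lt_natTrailingDegree (by omega), zero_smul]
    · rw [hDc k m h2, smul_zero]
  · intro h2
    exfalso
    apply h2
    rw [Finset.mem_range]
    have := Polynomial.le_natDegree_of_ne_zero hk
    omega

end UEAAux

/-- Let `g` be a finite-dimensional complex semisimple Lie algebra, `Δ₊` a choice of positive
roots, `α ∈ Δ₊` a positive root, and `f_α` a fixed nonzero element of the root space `g_{−α}`,
part of an sl₂-triple `(e_α, h_α, f_α)`.  Let `M` be a `U(g)`-module that is free as a module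
over the unital subalgebra `ℂ[f_α] ⊆ U(g)` generated by `f_α`.  Then the annihilator of
`T_α(M) = M_{(f_α)}/M` in `U(g)` equals the annihilator of `M` in `U(g)`. -/
theorem annihilator_twisted_eq_annihilator_of_free
    (L : Type) [LieRing L] [LieAlgebra ℂ L] [FiniteDimensional ℂ L]
    [LieAlgebra.IsSemisimple ℂ L]
    (H : LieSubalgebra ℂ L) [H.IsCartanSubalgebra]
    (Δplus : Finset (H → ℂ))
    (hΔ : ∀ γ ∈ Δplus, γ ≠ 0 ∧ rootSpace H γ ≠ ⊥)
    (hchoice : ∀ γ : H → ℂ, γ ≠ 0 → rootSpace H γ ≠ ⊥ → (γ ∈ Δplus ↔ (-γ) ∉ Δplus))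
    (α : H → ℂ) (hα : α ∈ Δplus)
    (eα hcoα fα : L) (htriple : IsSl2Triple hcoα eα fα)
    (heα : eα ∈ rootSpace H α) (hfα : fα ∈ rootSpace H (-α)) (hfα0 : fα ≠ 0)
    (M M' : Type) [AddCommGroup M] [Module (UniversalEnvelopingAlgebra ℂ L) M]
    [AddCommGroup M'] [Module (UniversalEnvelopingAlgebra ℂ L) M']
    [Module.Free
      (Algebra.adjoin ℂ
        ({(UniversalEnvelopingAlgebra.ι ℂ fα : UniversalEnvelopingAlgebra ℂ L)} :
          Set (UniversalEnvelopingAlgebra ℂ L))) M]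
    (ι : M →ₗ[UniversalEnvelopingAlgebra ℂ L] M')
    (hloc : IsOreLocalizationAtPowers
      ((UniversalEnvelopingAlgebra.ι ℂ fα : UniversalEnvelopingAlgebra ℂ L)) ι) :
    {a : UniversalEnvelopingAlgebra ℂ L | ∀ w : M' ⧸ LinearMap.range ι, a • w = 0} =
      {a : UniversalEnvelopingAlgebra ℂ L | ∀ v : M, a • v = 0} := by
  have hα0 : -α ≠ 0 := neg_ne_zero.2 (hΔ α hα).1
  have hnil : IsNilpotent (LieAlgebra.ad ℂ L fα) :=
    LieAlgebra.isNilpotent_ad_of_mem_rootSpace H hα0 hfα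
  have hhy : ⁅fα, hcoα⁆ = (2 : ℂ) • fα := by
    rw [← lie_skew, htriple.lie_lie_smul_f ℂ, neg_neg]
  have hfree := free_facts (UniversalEnvelopingAlgebra.ι ℂ fα : UniversalEnvelopingAlgebra ℂ L)
    (uea_transcendental hcoα fα hfα0 hhy) (M := M)
  exact ann_general hloc (uea_lnil fα hnil) hfree.1 hfree.2
end

section
/- Let g be a finite-dimensional complex semisimple Lie algebra with Killing form κ_g, Cartan subalgebra h, positive roots Δ₊, and Borel subalgebra b = h ⊕ n where n = ⊕_{γ∈Δ₊} g_γ. Define the symmetric bilinear form κ_c^b on h by κ_c^b(a, b) = −tr_{g/b}(ad(a) ∘ ad(b)), the negative of the trace of ad(a)∘ad(b) on the quotient module g/b. Let κ be a g-invariant symmetric bilinear form on g and let g = ⊕_{i=1}^r g_i be the decomposition of g into its simple ideals. If the restriction of κ to some simple ideal g_i equals −(1/2) times the restriction of κ_g to g_i, then the bilinear form (κ − κ_c^b) restricted to h is degenerate; and if the restriction of κ to every simple ideal g_i equals −(1/2) times the restriction of κ_g, then (κ − κ_c^b) vanishes identically on h. -/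
open LieAlgebra LieModule

variable (L : Type) [LieRing L] [LieAlgebra ℂ L]
  (H : LieSubalgebra ℂ L) [H.IsCartanSubalgebra]

/-- The Cartan subalgebra `h`, regarded as an `h`-submodule of the adjoint module `g`. -/
def cartanLieSubmodule : LieSubmodule ℂ H L :=
  { H.toSubmodule with lie_mem := fun {x} {_} hm => H.lie_mem x.2 hm }

/-- The Borel subalgebra `b = h ⊕ n`, with `n = ⊕_{γ ∈ Δ₊} g_γ`, regarded as an `h`-submodule
of the adjoint module `g`. -/
def borelLieSubmodule (Δplus : Finset (H → ℂ)) : LieSubmodule ℂ H L :=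
  cartanLieSubmodule L H ⊔ ⨆ γ ∈ Δplus, rootSpace H γ

/-- The critical form `κ_c^b(a, b) = −tr_{g/b}(ad(a) ∘ ad(b))` on the Cartan subalgebra. -/
noncomputable def criticalForm (Δplus : Finset (H → ℂ)) (a b : H) : ℂ :=
  -(LinearMap.trace ℂ (L ⧸ borelLieSubmodule L H Δplus)
      ((LieModule.toEnd ℂ H (L ⧸ borelLieSubmodule L H Δplus) a) ∘ₗ
        (LieModule.toEnd ℂ H (L ⧸ borelLieSubmodule L H Δplus) b)))

lemma aux_trace_quot {M : Type*} [AddCommGroup M] [Module ℂ M]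
    (p q : Submodule ℂ M) (h : IsCompl p q) (f : Module.End ℂ M)
    (hq : Set.MapsTo f q q) (g : Module.End ℂ (M ⧸ p))
    (hg : ∀ x, g (p.mkQ x) = p.mkQ (f x)) :
    LinearMap.trace ℂ (M ⧸ p) g = LinearMap.trace ℂ q (f.restrict hq) := by
  rw [← LinearMap.trace_conj' (f.restrict hq) (p.quotientEquivOfIsCompl q h).symm]
  congr 1
  ext x
  obtain ⟨y, hy⟩ := (p.quotientEquivOfIsCompl q h).symm.surjective (p.mkQ x)
  simp only [LinearMap.comp_apply, ← hy, LinearEquiv.conj_apply_apply,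
    LinearEquiv.symm_symm, LinearEquiv.apply_symm_apply]
  rw [Submodule.quotientEquivOfIsCompl_symm_apply, Submodule.quotientEquivOfIsCompl_symm_apply]
  exact hg y

open Classical in
lemma aux_trace_sum {M ι : Type*} [AddCommGroup M] [Module ℂ M] [FiniteDimensional ℂ M]
    [Fintype ι] (N : ι → Submodule ℂ M) (hind : iSupIndep N) (htop : ⨆ i, N i = ⊤)
    (P : ι → Prop) (p : Submodule ℂ M) (hp : p = ⨆ i, ⨆ (_ : P i), N i)
    (f : Module.End ℂ M) (hf : ∀ i, Set.MapsTo f (N i) (N i)) (g : Module.End ℂ (M ⧸ p))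
    (hg : ∀ x, g (p.mkQ x) = p.mkQ (f x)) :
    LinearMap.trace ℂ (M ⧸ p) g =
      ∑ i with ¬ P i, LinearMap.trace ℂ (N i) (f.restrict (hf i)) := by
  have hcompl : IsCompl p (⨆ i ∈ Finset.univ.filter (fun i => ¬ P i), N i) := by
    rw [hp]
    constructor
    · have := hind.disjoint_biSup_biSup (s := {i | P i}) (t := {i | ¬ P i})
        (by rw [Set.disjoint_left]; intro x hx hx'; exact hx' hx)
      simpa using this
    · rw [codisjoint_iff, eq_top_iff, ← htop]
      refine iSup_le fun i => ?_
      by_cases hi : P i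
      · exact le_sup_of_le_left (le_iSup₂_of_le i hi le_rfl)
      · exact le_sup_of_le_right (le_iSup₂_of_le i (by simpa using hi) le_rfl)
  have hq : Set.MapsTo f (⨆ i ∈ Finset.univ.filter (fun i => ¬ P i), N i : Submodule ℂ M)
      (⨆ i ∈ Finset.univ.filter (fun i => ¬ P i), N i : Submodule ℂ M) :=
    LinearMap.mapsTo_biSup_of_mapsTo
      ((Finset.univ.filter (fun i => ¬ P i) : Finset ι) : Set ι) hf
  rw [aux_trace_quot p _ hcompl f hq g hg]
  exact LinearMap.trace_eq_sum_trace_restrict_of_eq_biSup _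
    (hind.comp Subtype.val_injective) hf _ rfl hq

section
variable [FiniteDimensional ℂ L] [LieAlgebra.IsSemisimple ℂ L]

lemma aux_borel (Δplus : Finset (H → ℂ))
    (hΔ : ∀ γ ∈ Δplus, γ ≠ 0 ∧ rootSpace H γ ≠ ⊥) :
    borelLieSubmodule L H Δplus =
      ⨆ α ∈ {α : Weight ℂ H L | (α : H → ℂ) = 0 ∨ (α : H → ℂ) ∈ Δplus}, rootSpace H α := by
  have h0 : cartanLieSubmodule L H = rootSpace H (0 : H → ℂ) := by
    rw [rootSpace_zero_eq]; rfl
  unfold borelLieSubmodule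
  rw [h0]
  apply le_antisymm
  · refine sup_le ?_ (iSup₂_le fun γ hγ => ?_)
    · by_cases hb : rootSpace H (0 : H → ℂ) = ⊥
      · rw [hb]; exact bot_le
      · exact le_iSup₂_of_le (⟨0, hb⟩ : Weight ℂ H L) (Or.inl rfl) le_rfl
    · exact le_iSup₂_of_le (⟨γ, (hΔ γ hγ).2⟩ : Weight ℂ H L) (Or.inr hγ) le_rfl
  · refine iSup₂_le fun α hα => ?_
    rcases hα with hα | hα
    · rw [hα]; exact le_sup_left
    · exact le_sup_of_le_right (le_iSup₂_of_le _ hα le_rfl)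

open Classical in
lemma aux_critical (Δplus : Finset (H → ℂ))
    (hΔ : ∀ γ ∈ Δplus, γ ≠ 0 ∧ rootSpace H γ ≠ ⊥) (a b : H) :
    criticalForm L H Δplus a b =
      -∑ α ∈ (Finset.univ.filter fun α : Weight ℂ H L =>
        ¬ ((α : H → ℂ) = 0 ∨ (α : H → ℂ) ∈ Δplus)), α a * α b := by
  unfold criticalForm
  congr 1
  have hf : ∀ α : Weight ℂ H L, Set.MapsTo (toEnd ℂ H L a ∘ₗ toEnd ℂ H L b)
      ((rootSpace H α).toSubmodule) ((rootSpace H α).toSubmodule) :=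
    fun α m hm ↦ LieSubmodule.lie_mem _ <| LieSubmodule.lie_mem _ hm
  have h1 := aux_trace_sum (fun α : Weight ℂ H L => (rootSpace H α).toSubmodule)
    (LieSubmodule.iSupIndep_toSubmodule.mpr (iSupIndep_genWeightSpace' ℂ H L))
    (LieSubmodule.iSup_toSubmodule_eq_top.mpr (iSup_genWeightSpace_eq_top' ℂ H L))
    (fun α : Weight ℂ H L => (α : H → ℂ) = 0 ∨ (α : H → ℂ) ∈ Δplus)
    (borelLieSubmodule L H Δplus).toSubmodule
    (by rw [aux_borel L H Δplus hΔ]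
        simp only [LieSubmodule.iSup_toSubmodule, Set.mem_ofPred_eq])
    (toEnd ℂ H L a ∘ₗ toEnd ℂ H L b) hf
    ((LieModule.toEnd ℂ H (L ⧸ borelLieSubmodule L H Δplus) a) ∘ₗ
        (LieModule.toEnd ℂ H (L ⧸ borelLieSubmodule L H Δplus) b)) (fun x => rfl)
  refine h1.trans ?_
  refine Finset.sum_congr (by ext; simp) fun α hα => ?_
  have h2 := traceForm_genWeightSpace_eq ℂ H L α a b
  have hne : α.IsNonZero := by
    intro h
    exact (Finset.mem_filter.1 hα).2 (Or.inl h)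
  rw [IsKilling.finrank_rootSpace_eq_one α hne, one_smul] at h2
  exact h2

open Classical in
lemma aux_critical_eq (Δplus : Finset (H → ℂ))
    (hΔ : ∀ γ ∈ Δplus, γ ≠ 0 ∧ rootSpace H γ ≠ ⊥)
    (hchoice : ∀ γ : H → ℂ, γ ≠ 0 → rootSpace H γ ≠ ⊥ → (γ ∈ Δplus ↔ (-γ) ∉ Δplus))
    (a b : H) :
    criticalForm L H Δplus a b = -(1 / 2 : ℂ) * killingForm ℂ L a b := by
  rw [aux_critical L H Δplus hΔ]
  have hk : killingForm ℂ L a b = ∑ α ∈ (LieSubalgebra.root : Finset (Weight ℂ H L)), α a * α b := by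
    have := congr_arg (fun B : H →ₗ[ℂ] H →ₗ[ℂ] ℂ => B a b)
      (IsKilling.restrict_killingForm_eq_sum (K := ℂ) (L := L) (H := H))
    simp [LinearMap.sum_apply, mul_comm] at this
    exact this
  rw [hk, ← Finset.sum_filter_add_sum_filter_not (LieSubalgebra.root : Finset (Weight ℂ H L)) (fun α : Weight ℂ H L => (α : H → ℂ) ∈ Δplus)]
  have e1 : (Finset.univ.filter fun α : Weight ℂ H L => ¬ ((α : H → ℂ) = 0 ∨ (α : H → ℂ) ∈ Δplus))
      = (LieSubalgebra.root : Finset (Weight ℂ H L)).filter (fun α : Weight ℂ H L => ¬ (α : H → ℂ) ∈ Δplus) := by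
    ext α
    simp only [Finset.mem_filter, Finset.mem_univ, true_and, not_or]
    exact Iff.rfl
  have e2 : ∑ α ∈ (LieSubalgebra.root : Finset (Weight ℂ H L)).filter (fun α : Weight ℂ H L => (α : H → ℂ) ∈ Δplus), α a * α b
      = ∑ α ∈ (LieSubalgebra.root : Finset (Weight ℂ H L)).filter (fun α : Weight ℂ H L => ¬ (α : H → ℂ) ∈ Δplus), α a * α b := by
    refine Finset.sum_nbij' (fun α => -α) (fun α => -α) ?_ ?_ ?_ ?_ ?_
    · intro α hα
      simp only [Finset.mem_filter, Finset.mem_univ, true_and] at hα ⊢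
      refine ⟨hα.1.neg, ?_⟩
      rw [Weight.coe_neg]
      exact (hchoice α hα.1 α.genWeightSpace_ne_bot).1 hα.2
    · intro α hα
      simp only [Finset.mem_filter, Finset.mem_univ, true_and] at hα ⊢
      refine ⟨hα.1.neg, ?_⟩
      rw [Weight.coe_neg]
      by_contra hc
      exact hα.2 ((hchoice α hα.1 α.genWeightSpace_ne_bot).2 hc)
    · intro α _; simp
    · intro α _; simp
    · intro α _; simp
  rw [e1, e2]
  ring

lemma aux_lie_zero (I J : LieIdeal ℂ L) (h : Disjoint I J) {x y : L} (hx : x ∈ I) (hy : y ∈ J) :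
    ⁅x, y⁆ = 0 := by
  have h1 : ⁅x, y⁆ ∈ I ⊓ J := ⟨lie_mem_left ℂ L I x y hx, lie_mem_right ℂ L J x y hy⟩
  rw [h.eq_bot] at h1
  simpa using h1

lemma aux_perfect (I : LieIdeal ℂ L) : ⁅I, I⁆ = I := by
  have hle : ⁅I, I⁆ ≤ I := LieSubmodule.lie_le_right I I
  apply le_antisymm hle
  have hc := (⁅I, I⁆ : LieIdeal ℂ L).isCompl_killingCompl
  have hbot : I ⊓ (⁅I, I⁆ : LieIdeal ℂ L).killingCompl = ⊥ := by
    refine @IsKilling.ideal_eq_bot_of_isLieAbelian ℂ L _ _ _ _ _ _ _ _ _ ?_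
    rw [LieSubmodule.lie_abelian_iff_lie_self_eq_bot, LieSubmodule.lie_eq_bot_iff]
    rintro x ⟨hx, hx'⟩ y ⟨hy, hy'⟩
    have h1 : ⁅x, y⁆ ∈ ⁅I, I⁆ ⊓ (⁅I, I⁆ : LieIdeal ℂ L).killingCompl :=
      ⟨LieSubmodule.lie_mem_lie hx hy, lie_mem_right ℂ L _ x y hy'⟩
    rw [hc.inf_eq_bot] at h1
    simpa using h1
  intro x hx
  have hy : x ∈ ⁅I, I⁆ ⊔ (⁅I, I⁆ : LieIdeal ℂ L).killingCompl := by rw [hc.sup_eq_top]; trivial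
  obtain ⟨u, hu, v, hv, rfl⟩ := (LieSubmodule.mem_sup _ _ _).1 hy
  have hvI : v ∈ I := by simpa using sub_mem hx (hle hu)
  have hv0 : v ∈ I ⊓ (⁅I, I⁆ : LieIdeal ℂ L).killingCompl := ⟨hvI, hv⟩
  rw [hbot] at hv0
  have : v = 0 := by simpa using hv0
  simpa [this] using hu

lemma aux_orth (κ : L →ₗ[ℂ] L →ₗ[ℂ] ℂ)
    (hinv : ∀ x y z : L, κ ⁅x, y⁆ z + κ y ⁅x, z⁆ = 0)
    (I J : LieIdeal ℂ L) (h : Disjoint I J) {x y : L} (hx : x ∈ I) (hy : y ∈ J) :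
    κ x y = 0 := by
  rw [← aux_perfect L I, ← LieSubmodule.mem_toSubmodule,
    LieSubmodule.lieIdeal_oper_eq_linear_span'] at hx
  induction hx using Submodule.span_induction with
  | mem x hx =>
    obtain ⟨u, hu, v, hv, rfl⟩ := hx
    have := hinv u v y
    rwa [aux_lie_zero L I J h hu hy, map_zero, add_zero] at this
  | zero => simp
  | add _ _ _ _ h1 h2 => simp [h1, h2]
  | smul _ _ _ h1 => simp [h1]

lemma aux_killing_inv (x y z : L) :
    killingForm ℂ L ⁅x, y⁆ z + killingForm ℂ L y ⁅x, z⁆ = 0 := by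
  have := LieModule.traceForm_apply_lie_apply' ℂ L L x y z
  unfold killingForm
  rw [this]; ring

lemma aux_left (κ : L →ₗ[ℂ] L →ₗ[ℂ] ℂ)
    (hinv : ∀ x y z : L, κ ⁅x, y⁆ z + κ y ⁅x, z⁆ = 0) (I : LieIdeal ℂ L)
    (hI : ∀ x ∈ I, ∀ y ∈ I, κ x y = -(1 / 2 : ℂ) * killingForm ℂ L x y)
    {x : L} (hx : x ∈ I) (y : L) : κ x y = -(1 / 2 : ℂ) * killingForm ℂ L x y := by
  have hc := I.isCompl_killingCompl
  have hy : y ∈ I ⊔ I.killingCompl := by rw [hc.sup_eq_top]; trivial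
  obtain ⟨u, hu, v, hv, rfl⟩ := (LieSubmodule.mem_sup _ _ _).1 hy
  rw [map_add, map_add, hI x hx u hu, aux_orth L κ hinv I _ hc.disjoint hx hv,
    aux_orth L _ (aux_killing_inv L) I _ hc.disjoint hx hv]
  ring

lemma aux_exists (I : LieIdeal ℂ L) (hI : I ≠ ⊥) : ∃ a : H, a ≠ 0 ∧ (a : L) ∈ I := by
  by_contra! hcon
  have hcon' : ∀ x ∈ H, x ∈ I → x = 0 := fun x hx hxI => by
    by_contra hne
    exact hcon ⟨x, hx⟩ (fun h => hne (congr_arg Subtype.val h)) hxI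
  have hcent : ∀ x : L, (∀ h ∈ H, ⁅x, h⁆ = 0) → x ∈ H := fun x hx => by
    suffices x ∈ H.normalizer by rwa [LieSubalgebra.IsCartanSubalgebra.self_normalizing] at this
    exact (H.mem_normalizer_iff x).mpr fun z hz ↦ hx z hz ▸ LieSubalgebra.zero_mem H
  have hc := I.isCompl_killingCompl
  have hsub : ∀ h ∈ H, h ∈ I.killingCompl := fun h hh => by
    have hy : h ∈ I ⊔ I.killingCompl := by rw [hc.sup_eq_top]; trivial
    obtain ⟨u, hu, v, hv, rfl⟩ := (LieSubmodule.mem_sup _ _ _).1 hy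
    have hu0 : u = 0 := by
      refine hcon' u (hcent u fun k hk => ?_) hu
      have hab : ⁅u + v, k⁆ = 0 := by
        have := trivial_lie_zero H H (⟨u + v, hh⟩ : H) (⟨k, hk⟩ : H)
        simpa using congr_arg (Subtype.val) this
      rw [add_lie] at hab
      have h1 : ⁅u, k⁆ ∈ I ⊓ I.killingCompl := by
        refine ⟨lie_mem_left ℂ L I u k hu, ?_⟩
        rw [eq_neg_of_add_eq_zero_left hab]
        exact neg_mem (lie_mem_left ℂ L I.killingCompl v k hv)
      rw [hc.inf_eq_bot] at h1
      simpa using h1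
    simpa [hu0] using hv
  apply hI
  rw [eq_bot_iff]
  intro x hx
  have : x ∈ H := hcent x fun h hh => aux_lie_zero L I _ hc.disjoint hx (hsub h hh)
  simpa using hcon' x this hx

end

/-- Let `g` be a finite-dimensional complex semisimple Lie algebra with Killing form `κ_g`, Cartan
subalgebra `h`, a choice of positive roots `Δ₊` and Borel subalgebra `b = h ⊕ n`; let
`κ_c^b(a,b) = −tr_{g/b}(ad(a) ∘ ad(b))` and let `κ` be a `g`-invariant symmetric bilinear form
on `g`.  If the restriction of `κ` to some simple ideal `g_i` (an atom of the lattice of Lie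
ideals) equals `−(1/2)` times the restriction of `κ_g`, then `(κ − κ_c^b)|_h` is degenerate;
if this happens for every simple ideal, then `(κ − κ_c^b)` vanishes identically on `h`. -/
theorem partially_critical_criterion
    [FiniteDimensional ℂ L] [LieAlgebra.IsSemisimple ℂ L]
    (Δplus : Finset (H → ℂ))
    (hΔ : ∀ γ ∈ Δplus, γ ≠ 0 ∧ rootSpace H γ ≠ ⊥)
    (hchoice : ∀ γ : H → ℂ, γ ≠ 0 → rootSpace H γ ≠ ⊥ → (γ ∈ Δplus ↔ (-γ) ∉ Δplus))
    (κ : L →ₗ[ℂ] L →ₗ[ℂ] ℂ)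
    (hsymm : ∀ x y : L, κ x y = κ y x)
    (hinv : ∀ x y z : L, κ ⁅x, y⁆ z + κ y ⁅x, z⁆ = 0) :
    ((∃ I : LieIdeal ℂ L, IsAtom I ∧
        ∀ x ∈ I, ∀ y ∈ I, κ x y = -(1 / 2 : ℂ) * killingForm ℂ L x y) →
      ∃ a : H, a ≠ 0 ∧ ∀ b : H,
        κ (a : L) (b : L) - criticalForm L H Δplus a b = 0) ∧
    ((∀ I : LieIdeal ℂ L, IsAtom I →
        ∀ x ∈ I, ∀ y ∈ I, κ x y = -(1 / 2 : ℂ) * killingForm ℂ L x y) →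
      ∀ a b : H, κ (a : L) (b : L) - criticalForm L H Δplus a b = 0) := by
  refine ⟨?_, ?_⟩
  · rintro ⟨I, hI, hκ⟩
    obtain ⟨a, ha, haI⟩ := aux_exists L H I hI.1
    refine ⟨a, ha, fun b => ?_⟩
    rw [aux_critical_eq L H Δplus hΔ hchoice, aux_left L κ hinv I hκ haI, sub_self]
  · intro hκ a b
    rw [aux_critical_eq L H Δplus hΔ hchoice, sub_eq_zero]
    have ha : (a : L) ∈ sSup {I : LieIdeal ℂ L | IsAtom I} := by
      rw [IsSemisimple.sSup_atoms_eq_top]; trivial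
    rw [← LieSubmodule.mem_toSubmodule, LieSubmodule.sSup_toSubmodule_eq_iSup] at ha
    have key : ∀ x ∈ (⨆ I ∈ {I : LieIdeal ℂ L | IsAtom I}, I.toSubmodule : Submodule ℂ L),
        κ x b = -(1 / 2 : ℂ) * killingForm ℂ L x b := by
      intro x hx
      have hle : (⨆ I ∈ {I : LieIdeal ℂ L | IsAtom I}, I.toSubmodule : Submodule ℂ L) ≤
          LinearMap.ker ((κ.flip b) - (-(1 / 2 : ℂ)) • ((killingForm ℂ L).flip b)) := by
        refine iSup₂_le fun I hI y hy => ?_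
        have := aux_left L κ hinv I (hκ I hI) hy b
        simp [this]
      have := hle hx
      rw [LinearMap.mem_ker, LinearMap.sub_apply, sub_eq_zero] at this
      exact this
    exact key a ha
end
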